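/- arXiv:1403.0662 — 2 statements merged into one kernel-verified Lean document; each statement's English description precedes it below -/
import Mathlib

section
/- Let q be a prime with q ≡ 1 (mod 4) and let ε_q be the fundamental unit of ℚ(√q). Then the norm of ε_q from ℚ(√q) to ℚ equals -1. -/
open NumberField

/-- The negative Pell equation is solvable for a prime `q ≡ 1 (mod 4)`. -/
theorem neg_pell_aux (q : ℕ) (hq : q.Prime) (hq1 : q % 4 = 1) :
    ∃ x y : ℤ, x ^ 2 - q * y ^ 2 = -1 := by
  have hqI : Prime (q : ℤ) := Nat.prime_iff_prime_int.mp hq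
  have hq0 : (0 : ℤ) < q := by exact_mod_cast hq.pos
  obtain ⟨a, ha⟩ := Pell.IsFundamental.exists_of_not_isSquare hq0 hqI.irreducible.not_isSquare
  have hx1 : 1 < a.x := ha.1
  have hp := a.prop
  have hqm : (q : ℤ) % 4 = 1 := by omega
  obtain ⟨c, hc⟩ : ∃ c : ℤ, (q : ℤ) = 4 * c + 1 := ⟨q / 4, by omega⟩
  obtain ⟨z, hz⟩ : ∃ z, a.y = 2 * z := by
    rcases Int.even_or_odd' a.y with ⟨z, h | h⟩
    · exact ⟨z, h⟩
    · exfalso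
      rw [h] at hp
      rcases Int.even_or_odd' a.x with ⟨w, h' | h'⟩
      · rw [h', hc] at hp
        ring_nf at hp
        omega
      · rw [h', hc] at hp
        ring_nf at hp
        omega
  obtain ⟨m, hm⟩ : ∃ m, a.x = 2 * m + 1 := by
    rcases Int.even_or_odd' a.x with ⟨w, h' | h'⟩
    · exfalso
      rw [h', hz] at hp
      ring_nf at hp
      omega
    · exact ⟨w, h'⟩
  have hm1 : 1 ≤ m := by omega
  have key : m * (m + 1) = q * z ^ 2 := by
    rw [hm, hz] at hp
    linarith
  have hcop : IsCoprime m (m + 1) := ⟨-1, 1, by ring⟩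
  rcases hqI.dvd_or_dvd (Dvd.intro _ key.symm) with ⟨s, hs⟩ | ⟨s, hs⟩
  · exfalso
    have hs0 : 0 < s := by nlinarith
    have h2 : s * (m + 1) = z ^ 2 := by
      apply mul_left_cancel₀ hq0.ne'
      rw [← key]; nth_rewrite 2 [hs]; ring
    have hcop2 : IsCoprime s (m + 1) := by
      rw [hs] at hcop ⊢; exact hcop.of_mul_left_right
    obtain ⟨u, hu⟩ := Int.sq_of_isCoprime hcop2 h2
    obtain ⟨t, ht⟩ := Int.sq_of_isCoprime hcop2.symm (by rw [mul_comm]; exact h2)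
    have hu' : s = u ^ 2 := by rcases hu with h | h <;> nlinarith [sq_nonneg u]
    have ht' : m + 1 = t ^ 2 := by rcases ht with h | h <;> nlinarith [sq_nonneg t]
    have hsol : |t| ^ 2 - q * u ^ 2 = 1 := by
      rw [sq_abs, ← ht', ← hu', ← hs]; ring
    have h1t : 1 < |t| := by
      by_contra! hle
      have := abs_nonneg t
      have : |t| ^ 2 ≤ 1 := by nlinarith
      rw [sq_abs] at this
      omega
    have := ha.x_le_x (a := Pell.Solution₁.mk |t| u hsol) (by simpa using h1t)
    rw [Pell.Solution₁.x_mk] at this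
    have h3 : |t| ^ 2 = m + 1 := by rw [sq_abs, ht']
    nlinarith
  · have hs0 : 0 < s := by nlinarith
    have h2 : m * s = z ^ 2 := by
      apply mul_left_cancel₀ hq0.ne'
      rw [← key, hs]; ring
    have hcop2 : IsCoprime m s := by
      rw [hs] at hcop; exact hcop.of_mul_right_right
    obtain ⟨t, ht⟩ := Int.sq_of_isCoprime hcop2 h2
    obtain ⟨u, hu⟩ := Int.sq_of_isCoprime hcop2.symm (by rw [mul_comm]; exact h2)
    have hu' : s = u ^ 2 := by rcases hu with h | h <;> nlinarith [sq_nonneg u]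
    have ht' : m = t ^ 2 := by rcases ht with h | h <;> nlinarith [sq_nonneg t]
    exact ⟨t, u, by rw [← ht', ← hu']; linarith⟩

/-- Let `q` be a prime with `q ≡ 1 (mod 4)` and `ε` the fundamental unit of the real
quadratic field `K = ℚ(√q)`. Then the norm of `ε` from `K` to `ℚ` equals `-1`. -/
theorem stmt_10 (q : ℕ) (hq : q.Prime) (hq1 : q % 4 = 1)
    (K : Type*) [Field K] [NumberField K] (hdeg : Module.finrank ℚ K = 2)
    (sqq : K) (hsqq : sqq ^ 2 = (q : K))
    (ε : (𝓞 K)ˣ)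
    (hεinf : ∀ m : ℕ, 0 < m → ε ^ m ≠ 1)
    (hεfund : ∀ u : (𝓞 K)ˣ, ∃ (ζ : (𝓞 K)ˣ) (k : ℤ),
      (∃ m : ℕ, 0 < m ∧ ζ ^ m = 1) ∧ u = ζ * ε ^ k) :
    Algebra.norm ℚ ((ε : 𝓞 K) : K) = -1 := by
  obtain ⟨x, y, hxy⟩ := neg_pell_aux q hq hq1
  -- the basis `1, √q`
  have hirr : ∀ r : ℚ, algebraMap ℚ K r ≠ sqq := by
    intro r hr
    have h : r ^ 2 = q := by
      apply (algebraMap ℚ K).injective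
      rw [map_pow, hr, hsqq, map_natCast]
    have h2 : IsSquare ((q : ℚ)) := ⟨r, by rw [← h, sq]⟩
    rw [Rat.isSquare_natCast_iff] at h2
    exact hq.prime.irreducible.not_isSquare h2
  have hli : LinearIndependent ℚ ![(1 : K), sqq] := by
    rw [LinearIndependent.pair_iff' one_ne_zero]
    intro r hr
    exact hirr r (by rw [Algebra.algebraMap_eq_smul_one, hr])
  let b : Module.Basis (Fin 2) ℚ K :=
    basisOfLinearIndependentOfCardEqFinrank hli (by simp [hdeg])
  have hb0 : b 0 = 1 := by simp [b]
  have hb1 : b 1 = sqq := by simp [b]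
  have hrepr : ∀ z : K, ∃ r s : ℚ, z = algebraMap ℚ K r + algebraMap ℚ K s * sqq := by
    intro z
    refine ⟨b.repr z 0, b.repr z 1, ?_⟩
    conv_lhs => rw [← b.sum_repr z]
    rw [Fin.sum_univ_two, hb0, hb1, Algebra.smul_def, Algebra.smul_def, mul_one]
  have hnorm : ∀ r s : ℚ, Algebra.norm ℚ (algebraMap ℚ K r + algebraMap ℚ K s * sqq)
      = r ^ 2 - q * s ^ 2 := by
    intro r s
    have e0 : (algebraMap ℚ K r + algebraMap ℚ K s * sqq) * b 0 = r • b 0 + s • b 1 := by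
      rw [hb0, hb1, Algebra.smul_def, Algebra.smul_def]; ring
    have e1 : (algebraMap ℚ K r + algebraMap ℚ K s * sqq) * b 1
        = (q * s) • b 0 + r • b 1 := by
      rw [hb0, hb1, Algebra.smul_def, Algebra.smul_def, map_mul, map_natCast, ← hsqq]; ring
    rw [Algebra.norm_eq_matrix_det b, Matrix.det_fin_two]
    simp only [Algebra.leftMulMatrix_eq_repr_mul, e0, e1, map_add, map_smul, Finsupp.add_apply,
      Finsupp.smul_apply, Module.Basis.repr_self, smul_eq_mul]
    simp
    ring
  -- roots of unity have norm one
  have hroot : ∀ ζ : (𝓞 K)ˣ, (∃ m : ℕ, 0 < m ∧ ζ ^ m = 1) →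
      Algebra.norm ℚ ((ζ : 𝓞 K) : K) = 1 := by
    rintro ζ ⟨m, hm, hζ⟩
    have hζK : ((ζ : 𝓞 K) : K) ^ m = 1 := by
      have := congrArg (fun u : (𝓞 K)ˣ => ((u : 𝓞 K) : K)) hζ
      simpa using this
    set w : K := ((ζ : 𝓞 K) : K) with hw
    obtain ⟨φ⟩ : Nonempty (K →+* ℂ) := inferInstance
    have hφ : ((Real.sqrt q : ℝ) : ℂ) ^ 2 = (φ sqq) ^ 2 := by
      rw [← map_pow, hsqq, map_natCast, ← Complex.ofReal_pow, Real.sq_sqrt (by positivity)]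
      simp
    obtain ⟨ρ, hρ⟩ : ∃ ρ : ℝ, φ sqq = ρ := by
      rcases sq_eq_sq_iff_eq_or_eq_neg.mp hφ with h | h
      · exact ⟨_, h.symm⟩
      · exact ⟨-Real.sqrt q, by rw [Complex.ofReal_neg, h, neg_neg]⟩
    obtain ⟨r, s, hrs⟩ := hrepr w
    obtain ⟨σ, hσ⟩ : ∃ σ : ℝ, φ w = σ := ⟨r + s * ρ, by rw [hrs]; simp [hρ]⟩
    have hσm : σ ^ m = 1 := by
      have : φ w ^ m = 1 := by rw [← map_pow, hζK, map_one]
      rw [hσ] at this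
      exact_mod_cast this
    have habs : |σ| = 1 := by
      apply (pow_eq_one_iff_of_nonneg (abs_nonneg σ) hm.ne').mp
      rw [← abs_pow, hσm, abs_one]
    have hw1 : w = 1 ∨ w = -1 := by
      rcases (abs_eq zero_le_one).mp habs with h | h
      · left; apply φ.injective; rw [hσ, h]; simp
      · right; apply φ.injective; rw [hσ, h]; simp
    rcases hw1 with h | h
    · rw [h, map_one]
    · have : (-1 : K) = algebraMap ℚ K (-1) := by simp
      rw [h, this, Algebra.norm_algebraMap, hdeg]; norm_num
  -- the unit of norm `-1`
  have hintegral : ∀ x y : ℤ, IsIntegral ℤ ((x : K) + y * sqq) := by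
    intro x y
    have hs : IsIntegral ℤ sqq := by
      apply IsIntegral.of_pow (n := 2) (by norm_num)
      rw [hsqq]
      exact_mod_cast isIntegral_algebraMap (R := ℤ) (A := K) (x := (q : ℤ))
    exact (isIntegral_algebraMap (x := x)).add ((isIntegral_algebraMap (x := y)).mul hs)
  have hxyK : (x : K) ^ 2 - q * y ^ 2 = -1 := by exact_mod_cast congrArg (Int.cast : ℤ → K) hxy
  have hprod : ((x : K) + y * sqq) * (((-x : ℤ) : K) + y * sqq) = 1 := by
    push_cast
    linear_combination (y : K) ^ 2 * hsqq - hxyK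
  let η : (𝓞 K)ˣ := Units.mkOfMulEqOne (⟨_, hintegral x y⟩ : 𝓞 K) ⟨_, hintegral (-x) y⟩
    (by apply RingOfIntegers.ext; exact hprod)
  have hη : ((η : 𝓞 K) : K) = (x : K) + y * sqq := rfl
  have hηn : Algebra.norm ℚ ((η : 𝓞 K) : K) = -1 := by
    have := hnorm x y
    rw [map_intCast, map_intCast] at this
    rw [hη, this]
    exact_mod_cast hxy
  obtain ⟨ζ, k, hζ, hk⟩ := hεfund η
  have hε : |Algebra.norm ℚ ((ε : 𝓞 K) : K)| = 1 := by
    simp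
  rcases (abs_eq zero_le_one).mp hε with h | h
  · exfalso
    let N : (𝓞 K)ˣ →* ℚˣ :=
      Units.map ((Algebra.norm ℚ).comp (algebraMap (𝓞 K) K : 𝓞 K →* K))
    have hN : ∀ u : (𝓞 K)ˣ, ((N u : ℚˣ) : ℚ) = Algebra.norm ℚ ((u : 𝓞 K) : K) := fun _ => rfl
    have hNε : N ε = 1 := Units.ext (by rw [hN, h]; rfl)
    have hNζ : N ζ = 1 := Units.ext (by rw [hN, hroot ζ hζ]; rfl)
    rw [← hN, hk, map_mul, map_zpow, hNε, hNζ] at hηn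
    norm_num at hηn
  · exact h
end

section
/- Let p and q be distinct primes with p ≡ 1 (mod 8) and q ≡ 5 (mod 8). Then the unit group of the ring of integers of F = ℚ(√q, i) is generated by i and the fundamental unit ε_q of ℚ(√q), i.e., every unit is of the form i^a · ε_q^b. -/
open NumberField

/-- A rational whose square is an integer is an integer. -/
lemma aux_rat_sq (x : ℚ) (z : ℤ) (h : x ^ 2 = z) : ∃ c : ℤ, x = c := by
  have hi : IsIntegral ℤ x := by
    apply IsIntegral.of_pow (n := 2) (by norm_num)
    rw [h]
    exact isIntegral_algebraMap (R := ℤ) (A := ℚ) (x := z)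
  obtain ⟨c, hc⟩ := IsIntegrallyClosed.isIntegral_iff.mp hi
  exact ⟨c, by rw [← hc]; simp⟩

lemma aux_rat_qsq (q : ℕ) (hq : q.Prime) (x : ℚ) (z : ℤ) (h : (q : ℚ) * x ^ 2 = z) :
    ∃ c : ℤ, x = c := by
  obtain ⟨c, hc⟩ := aux_rat_sq (q * x) (q * z) (by push_cast; rw [← h]; ring)
  have hq0 : (q : ℚ) ≠ 0 := by exact_mod_cast hq.ne_zero
  have h1 : c ^ 2 = q * z := by
    have : (c : ℚ) ^ 2 = q * z := by rw [← hc, ← h]; ring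
    exact_mod_cast this
  have hqi : Prime (q : ℤ) := Nat.prime_iff_prime_int.mp hq
  obtain ⟨d, hd⟩ := hqi.dvd_of_dvd_pow (Dvd.intro _ h1.symm)
  refine ⟨d, ?_⟩
  rw [hd] at hc
  push_cast at hc
  exact mul_left_cancel₀ hq0 hc

lemma aux_no_sq (q : ℕ) (hq5 : q % 8 = 5) (x : ℚ) : x ^ 2 ≠ q := by
  intro h
  obtain ⟨c, hc⟩ := aux_rat_sq x q (by rw [h]; simp)
  have h1 : c ^ 2 = q := by
    rw [hc] at h; exact_mod_cast h
  have h2 : (q : ℤ) % 8 = 5 := by omega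
  rw [← h1] at h2
  have h3 : c % 8 = 0 ∨ c % 8 = 1 ∨ c % 8 = 2 ∨ c % 8 = 3 ∨ c % 8 = 4 ∨ c % 8 = 5 ∨ c % 8 = 6
    ∨ c % 8 = 7 := by omega
  rcases h3 with h | h | h | h | h | h | h | h <;> simp [pow_two, Int.mul_emod, h] at h2

/-- Quadratic extensions have basis `1, t`. -/
lemma aux_basis (k L : Type*) [Field k] [Field L] [Algebra k L] (h : Module.finrank k L = 2)
    (t : L) (ht : ∀ x : k, algebraMap k L x ≠ t) (z : L) :
    ∃ x y : k, z = algebraMap k L x + algebraMap k L y * t := by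
  have hli : LinearIndependent k ![(1 : L), t] := by
    rw [LinearIndependent.pair_iff]
    intro s u hsu
    have hu : u = 0 := by
      by_contra hu
      apply ht (-s / u)
      have hu' : algebraMap k L u ≠ 0 := by simpa using hu
      rw [Algebra.smul_def, Algebra.smul_def] at hsu
      rw [map_div₀, map_neg]
      field_simp
      linear_combination (-1 : L) * hsu
    refine ⟨?_, hu⟩
    rw [hu] at hsu
    simpa using hsu
  have : FiniteDimensional k L := FiniteDimensional.of_finrank_pos (by omega)
  have hs := hli.span_eq_top_of_card_eq_finrank' (by simp [h])
  have hz : z ∈ Submodule.span k (Set.range ![(1 : L), t]) := by rw [hs]; trivial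
  simp only [Matrix.range_cons, Matrix.range_empty, Set.union_empty,
    Set.singleton_union] at hz
  rw [Submodule.mem_span_pair] at hz
  obtain ⟨x, y, hxy⟩ := hz
  refine ⟨x, y, ?_⟩
  rw [← hxy, Algebra.smul_def, Algebra.smul_def, mul_one]


lemma aux_irr {K : Type*} [Field K] [CharZero K] (q : ℕ) (hq5 : q % 8 = 5)
    (r : K) (hr : r ^ 2 = (q : K)) (x y : ℚ) (h : (x : K) + y * r = 0) : x = 0 ∧ y = 0 := by
  have hy : y = 0 := by
    by_contra hy
    apply aux_no_sq q hq5 (x / y)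
    have hy' : (y : K) ≠ 0 := by exact_mod_cast hy
    have : ((x : K) / y) ^ 2 = q := by
      rw [← hr]
      field_simp
      linear_combination ((x : K) - y * r) * h
    exact_mod_cast this
  subst hy
  simpa using h

lemma aux_int {K : Type*} [Field K] [CharZero K] (q : ℕ) (hq : q.Prime) (hq5 : q % 8 = 5)
    (r : K) (hr : r ^ 2 = (q : K)) (a b : ℚ) (h : IsIntegral ℤ ((a : K) + b * r)) :
    ∃ A B : ℤ, 2 * a = A ∧ 2 * b = B ∧ 4 ∣ A ^ 2 - q * B ^ 2 := by
  have key : ∃ A N : ℤ, 2 * a = A ∧ a ^ 2 - q * b ^ 2 = N := by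
    by_cases hb : b = 0
    · subst hb
      have h' : IsIntegral ℤ (algebraMap ℚ K a) := by simpa using h
      rw [isIntegral_algebraMap_iff (algebraMap ℚ K).injective] at h'
      obtain ⟨c, hc⟩ := IsIntegrallyClosed.isIntegral_iff.mp h'
      simp at hc
      exact ⟨2 * c, c ^ 2, by simp [← hc], by simp [← hc]⟩
    · have hm : minpoly ℚ ((a : K) + b * r) =
          Polynomial.X ^ 2 + Polynomial.C (-(2 * a)) * Polynomial.X
            + Polynomial.C (a ^ 2 - q * b ^ 2) := by
        have hmon : (Polynomial.X ^ 2 + Polynomial.C (-(2 * a)) * Polynomial.X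
            + Polynomial.C (a ^ 2 - q * b ^ 2) : Polynomial ℚ).Monic := by monicity!
        have hdeg : (Polynomial.X ^ 2 + Polynomial.C (-(2 * a)) * Polynomial.X
            + Polynomial.C (a ^ 2 - q * b ^ 2) : Polynomial ℚ).natDegree = 2 := by
          compute_degree!
        have hev : Polynomial.aeval ((a : K) + b * r) (Polynomial.X ^ 2 + Polynomial.C (-(2 * a)) * Polynomial.X
            + Polynomial.C (a ^ 2 - q * b ^ 2) : Polynomial ℚ) = 0 := by
          simp
          linear_combination (b : K) ^ 2 * hr
        have hint : IsIntegral ℚ ((a : K) + b * r) := h.tower_top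
        have hdvd := minpoly.dvd ℚ _ hev
        have h2 : 2 ≤ (minpoly ℚ ((a : K) + b * r)).natDegree := by
          rw [minpoly.two_le_natDegree_iff hint]
          rintro ⟨y, hy⟩
          simp at hy
          have := aux_irr q hq5 r hr (a - y) b (by push_cast; rw [hy]; ring)
          exact hb this.2
        exact (Polynomial.eq_of_monic_of_dvd_of_natDegree_le (minpoly.monic hint) hmon hdvd
          (by rw [hdeg]; exact h2)).symm
      have hZ := minpoly.isIntegrallyClosed_eq_field_fractions' ℚ h
      rw [hm] at hZ
      generalize a ^ 2 - (q : ℚ) * b ^ 2 = c at hZ ⊢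
      have h1 := congrArg (fun p => Polynomial.coeff p 1) hZ
      have h0 := congrArg (fun p => Polynomial.coeff p 0) hZ
      simp [Polynomial.coeff_X, Polynomial.coeff_C] at h1 h0
      exact ⟨-(minpoly ℤ ((a : K) + b * r)).coeff 1, (minpoly ℤ ((a : K) + b * r)).coeff 0,
        by push_cast; rw [← h1]; ring, h0⟩
  obtain ⟨A, N, hA, hN⟩ := key
  obtain ⟨B, hB⟩ := aux_rat_qsq q hq (2 * b) (A ^ 2 - 4 * N) (by
    push_cast; rw [← hA, ← hN]; ring)
  refine ⟨A, B, hA, hB, N, ?_⟩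
  have : (A : ℚ) ^ 2 - q * B ^ 2 = 4 * N := by rw [← hA, ← hB, ← hN]; ring
  exact_mod_cast this


lemma aux_dioph (q : ℕ) (hq : q.Prime) (hq5 : q % 8 = 5) (A B : ℤ) (E F : ℚ)
    (h4 : (4 : ℤ) ∣ A ^ 2 - q * B ^ 2)
    (h1 : (A : ℚ) ^ 2 + q * B ^ 2 + E ^ 2 + q * F ^ 2 = 16) (h2 : (A : ℚ) * B + E * F = 0) :
    (A = 0 ∧ B = 0) ∨ (E = 0 ∧ F = 0) := by
  have hq0 : 5 ≤ q := by omega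
  have hqQ : (5 : ℚ) ≤ q := by exact_mod_cast hq0
  have hb : A ^ 2 + q * B ^ 2 ≤ 16 := by
    have : (A : ℚ) ^ 2 + q * B ^ 2 ≤ 16 := by nlinarith [sq_nonneg E, sq_nonneg F]
    exact_mod_cast this
  have hqB : (5 : ℤ) * B ^ 2 ≤ q * B ^ 2 := by
    have : (5 : ℤ) ≤ q := by exact_mod_cast hq0
    nlinarith [sq_nonneg B]
  have hA1 : A ≤ 4 := by nlinarith [sq_nonneg B]
  have hA2 : -4 ≤ A := by nlinarith [sq_nonneg B]
  have hB1 : B ≤ 1 := by nlinarith [sq_nonneg A]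
  have hB2 : -1 ≤ B := by nlinarith [sq_nonneg A]
  have hsq : (E ^ 2 - q * F ^ 2) ^ 2 = (16 - A ^ 2 - q * B ^ 2) ^ 2 - 4 * q * (A * B) ^ 2 := by
    have e1 : E ^ 2 + q * F ^ 2 = 16 - A ^ 2 - q * B ^ 2 := by linarith
    have e2 : (A : ℚ) * B = - (E * F) := by linarith
    rw [← e1, e2]; ring
  by_cases hB : B = 0
  · subst hB
    have hEF : E = 0 ∨ F = 0 := by simpa using h2
    by_cases hA : A = 0
    · left; exact ⟨hA, rfl⟩
    right
    have hev : A % 2 = 0 := by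
      have h4' : (4 : ℤ) ∣ A ^ 2 := by simpa using h4
      have : Even (A ^ 2) := by
        rw [even_iff_two_dvd]; exact dvd_trans (by norm_num) h4'
      rw [Int.even_pow] at this
      exact Int.even_iff.mp this.1
    have hcases : A ^ 2 = 4 ∨ A ^ 2 = 16 := by
      interval_cases A <;> simp_all
    rcases hcases with h | h
    · exfalso
      have h' : (A : ℚ) ^ 2 = 4 := by exact_mod_cast h
      rcases hEF with h0 | h0
      · subst h0
        have h3 : (q : ℚ) * F ^ 2 = (12 : ℤ) := by push_cast; nlinarith
        obtain ⟨c, hc⟩ := aux_rat_qsq q hq F 12 h3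
        rw [hc] at h3
        have h5 : (q : ℤ) * c ^ 2 = 12 := by exact_mod_cast h3
        have h6 : (q : ℤ) ∣ 12 := Dvd.intro _ h5
        have h7 : q ∣ 12 := by exact_mod_cast h6
        have h8 := Nat.le_of_dvd (by norm_num) h7
        interval_cases q <;> omega
      · subst h0
        have h3 : E ^ 2 = (12 : ℤ) := by push_cast; nlinarith
        obtain ⟨c, hc⟩ := aux_rat_sq E 12 h3
        rw [hc] at h3
        have h5 : c ^ 2 = 12 := by exact_mod_cast h3
        have : c ≤ 3 := by nlinarith
        have : -3 ≤ c := by nlinarith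
        interval_cases c <;> omega
    · have h' : (A : ℚ) ^ 2 = 16 := by exact_mod_cast h
      have h3 : E ^ 2 + q * F ^ 2 = 0 := by simp at h1; linarith
      have hE : E ^ 2 = 0 := by nlinarith [sq_nonneg E, sq_nonneg F]
      have hF : F ^ 2 = 0 := by nlinarith [sq_nonneg E, sq_nonneg F]
      exact ⟨by simpa using hE, by simpa using hF⟩
  · exfalso
    have hBB : B ^ 2 = 1 := by interval_cases B <;> simp_all
    rw [hBB] at hb h4
    have hq16 : q ≤ 16 := by
      have : (q : ℤ) ≤ 16 := by nlinarith [sq_nonneg A]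
      exact_mod_cast this
    have hBQ : (B : ℚ) ^ 2 = 1 := by exact_mod_cast hBB
    rw [mul_pow, hBQ] at hsq
    have hqq : q = 5 ∨ q = 13 := by omega
    have hAA : (q = 5 ∧ A ^ 2 = 1) ∨ (q = 5 ∧ A ^ 2 = 9) ∨ (q = 13 ∧ A ^ 2 = 1) := by
      rcases hqq with h | h <;> subst h <;> interval_cases A <;> simp_all <;> omega
    rcases hAA with ⟨h, h'⟩ | ⟨h, h'⟩ | ⟨h, h'⟩
    · have h'' : (A : ℚ) ^ 2 = 1 := by exact_mod_cast h'
      subst h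
      rw [h''] at hsq
      have h3 : (E ^ 2 - (5 : ℕ) * F ^ 2) ^ 2 = (80 : ℤ) := by rw [hsq]; norm_num
      obtain ⟨c, hc⟩ := aux_rat_sq _ 80 h3
      rw [hc] at h3
      have h5 : c ^ 2 = 80 := by exact_mod_cast h3
      have : c ≤ 8 := by nlinarith
      have : -8 ≤ c := by nlinarith
      interval_cases c <;> omega
    · have h'' : (A : ℚ) ^ 2 = 9 := by exact_mod_cast h'
      subst h
      rw [h''] at hsq
      have := sq_nonneg (E ^ 2 - (5 : ℕ) * F ^ 2)
      rw [hsq] at this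
      norm_num at this
    · have h'' : (A : ℚ) ^ 2 = 1 := by exact_mod_cast h'
      subst h
      rw [h''] at hsq
      have := sq_nonneg (E ^ 2 - (13 : ℕ) * F ^ 2)
      rw [hsq] at this
      norm_num at this


lemma aux_coord {K : Type*} [Field K] [NumberField K] (q : ℕ) (hq5 : q % 8 = 5) (hdegK : Module.finrank ℚ K = 2)
    (r : K) (hr : r ^ 2 = (q : K)) (z : K) : ∃ a b : ℚ, z = (a : K) + b * r := by
  have := aux_basis ℚ K hdegK r (by
    intro x hx
    apply aux_no_sq q hq5 x
    rw [← hx] at hr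
    simp at hr
    exact_mod_cast hr) z
  simpa using this

lemma aux_sq_ne {K : Type*} [Field K] [NumberField K] (q : ℕ) (hq5 : q % 8 = 5) (hdegK : Module.finrank ℚ K = 2)
    (r : K) (hr : r ^ 2 = (q : K)) (t : K) : t ^ 2 ≠ -1 := by
  intro h
  obtain ⟨a, b, rfl⟩ := aux_coord q hq5 hdegK r hr t
  have := aux_irr q hq5 r hr (a ^ 2 + q * b ^ 2 + 1) (2 * a * b) (by
    push_cast; linear_combination h - (b : K) ^ 2 * hr)
  nlinarith [this.1, sq_nonneg a, mul_nonneg (Nat.cast_nonneg (α := ℚ) q) (sq_nonneg b)]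

lemma aux_cd {K : Type*} [Field K] [NumberField K] (q : ℕ) (hq : q.Prime) (hq5 : q % 8 = 5) (hdegK : Module.finrank ℚ K = 2)
    (r : K) (hr : r ^ 2 = (q : K)) (c d : K) (h : c ^ 2 + d ^ 2 = 1) (hc : IsIntegral ℤ (2 * c)) : c = 0 ∨ d = 0 := by
  obtain ⟨a, b, rfl⟩ := aux_coord q hq5 hdegK r hr c
  obtain ⟨e, f, rfl⟩ := aux_coord q hq5 hdegK r hr d
  have h1 := aux_irr q hq5 r hr (a ^ 2 + q * b ^ 2 + e ^ 2 + q * f ^ 2 - 1)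
    (2 * (a * b + e * f)) (by
    push_cast; linear_combination h - ((b : K) ^ 2 + f ^ 2) * hr)
  obtain ⟨A, B, hA, hB, h4⟩ := aux_int q hq hq5 r hr (2 * a) (2 * b) (by
    convert hc using 1; push_cast; ring)
  have := aux_dioph q hq hq5 A B (4 * e) (4 * f) h4 (by
    rw [← hA, ← hB]; linear_combination 16 * h1.1) (by
    rw [← hA, ← hB]; linear_combination 8 * h1.2)
  rcases this with ⟨hA0, hB0⟩ | ⟨hA0, hB0⟩
  · left
    subst hA0 hB0
    have ha : a = 0 := by simpa using hA
    have hb : b = 0 := by simpa using hB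
    simp [ha, hb]
  · right
    have ha : e = 0 := by simpa using hA0
    have hb : f = 0 := by simpa using hB0
    simp [ha, hb]

/-- `2` is inert in `ℚ(√q)`. -/
lemma aux_inert {K : Type*} [Field K] [NumberField K] (q : ℕ) (hq : q.Prime) (hq5 : q % 8 = 5) (hdegK : Module.finrank ℚ K = 2)
    (r : K) (hr : r ^ 2 = (q : K)) (t η : K) (ht : IsIntegral ℤ t) (hη : IsIntegral ℤ η) (h : t ^ 2 = 2 * η) :
    IsIntegral ℤ (t / 2) := by
  obtain ⟨a, b, rfl⟩ := aux_coord q hq5 hdegK r hr t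
  obtain ⟨A, B, hA, hB, N, hN⟩ := aux_int q hq hq5 r hr a b ht
  have hη' : η = (((a ^ 2 + q * b ^ 2) / 2 : ℚ) : K) + ((a * b : ℚ) : K) * r := by
    push_cast
    have : (2 : K) ≠ 0 := two_ne_zero
    field_simp
    linear_combination -h + (b : K) ^ 2 * hr
  rw [hη'] at hη
  obtain ⟨P, Q, hP, hQ, M, hM⟩ := aux_int q hq hq5 r hr _ _ hη
  have hNM : N ^ 2 = 4 * M := by
    have hNQ : (A : ℚ) ^ 2 - q * B ^ 2 = 4 * N := by exact_mod_cast hN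
    have hMQ : (P : ℚ) ^ 2 - q * Q ^ 2 = 4 * M := by exact_mod_cast hM
    rw [← hA, ← hB] at hNQ
    rw [← hP, ← hQ] at hMQ
    have : (N : ℚ) ^ 2 = 4 * M := by
      have e : (N : ℚ) = a ^ 2 - q * b ^ 2 := by linarith
      rw [e, ← hMQ]; ring
    exact_mod_cast this
  have hNe : N % 2 = 0 := by
    have : Even (N ^ 2) := by rw [hNM]; exact ⟨2 * M, by ring⟩
    rw [Int.even_pow] at this
    exact Int.even_iff.mp this.1
  obtain ⟨n, hn⟩ : ∃ n, N = 2 * n := ⟨N / 2, by omega⟩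
  obtain ⟨k, hk⟩ : ∃ k : ℤ, (q : ℤ) = 8 * k + 5 := ⟨q / 8, by omega⟩
  have h8 : A ^ 2 - 5 * B ^ 2 = 8 * (n + k * B ^ 2) := by
    rw [hk, hn] at hN; linear_combination hN
  have hpar : A % 2 = 0 ∧ B % 2 = 0 := by
    have h8' : (A ^ 2 - 5 * B ^ 2) % 8 = 0 := by omega
    have hA8 : A % 8 = 0 ∨ A % 8 = 1 ∨ A % 8 = 2 ∨ A % 8 = 3 ∨ A % 8 = 4 ∨ A % 8 = 5 ∨
      A % 8 = 6 ∨ A % 8 = 7 := by omega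
    have hB8 : B % 8 = 0 ∨ B % 8 = 1 ∨ B % 8 = 2 ∨ B % 8 = 3 ∨ B % 8 = 4 ∨ B % 8 = 5 ∨
      B % 8 = 6 ∨ B % 8 = 7 := by omega
    rcases hA8 with h | h | h | h | h | h | h | h <;>
    rcases hB8 with h' | h' | h' | h' | h' | h' | h' | h' <;>
    first
    | (constructor <;> omega)
    | (exfalso; simp [pow_two, Int.mul_emod, Int.sub_emod, h, h'] at h8')
  obtain ⟨A', hA'⟩ : ∃ n, A = 2 * n := ⟨A / 2, by omega⟩
  obtain ⟨B', hB'⟩ : ∃ n, B = 2 * n := ⟨B / 2, by omega⟩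
  have ha : a = A' := by rw [hA'] at hA; push_cast at hA; linarith
  have hb : b = B' := by rw [hB'] at hB; push_cast at hB; linarith
  have hNN : A' ^ 2 - q * B' ^ 2 = 2 * n := by
    rw [hA', hB', hn] at hN; linarith
  have h44 : ∃ m, A' ^ 2 - q * B' ^ 2 = 4 * m := by
    have hs : (A' - B') % 2 = 0 := by
      have : Even ((A' ^ 2 - q * B' ^ 2)) := by rw [hNN]; exact even_two_mul n
      have hqo : ¬ Even (q : ℤ) := by rw [Int.even_iff]; omega
      simp [Int.even_sub, Int.even_mul, Int.even_pow, hqo] at this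
      rw [← Int.even_iff, Int.even_sub]
      exact this
    obtain ⟨j, hj⟩ : ∃ j, A' = B' + 2 * j := ⟨(A' - B') / 2, by omega⟩
    refine ⟨j * B' + j ^ 2 - (2 * k + 1) * B' ^ 2, ?_⟩
    rw [hj, hk]; ring
  obtain ⟨m, hm⟩ := h44
  refine ⟨Polynomial.X ^ 2 + Polynomial.C (-A') * Polynomial.X + Polynomial.C m, by monicity!, ?_⟩
  have hmK : (A' : K) ^ 2 - q * B' ^ 2 = 4 * m := by exact_mod_cast hm
  rw [ha, hb]
  simp only [Polynomial.eval₂_add, Polynomial.eval₂_mul, Polynomial.eval₂_pow, Polynomial.eval₂_X,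
    Polynomial.eval₂_C, Rat.cast_intCast]
  simp only [map_neg, eq_intCast]
  have : (4 : K) ≠ 0 := by norm_num
  apply mul_left_cancel₀ this
  linear_combination (B' : K) ^ 2 * hr - hmK


lemma aux_congr {L : Type*} [Field L] {a b : L} (h : IsIntegral ℤ a) (e : b = a) :
    IsIntegral ℤ b := e ▸ h

lemma aux_half {L : Type*} [Field L] [CharZero L] : ¬ IsIntegral ℤ ((1 : L) / 2) := by
  intro h
  have h' : IsIntegral ℤ (algebraMap ℚ L (1 / 2)) := by simpa using h
  rw [isIntegral_algebraMap_iff (algebraMap ℚ L).injective] at h'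
  obtain ⟨c, hc⟩ := IsIntegrallyClosed.isIntegral_iff.mp h'
  simp at hc
  have : (c : ℚ) * 2 = 1 := by rw [hc]; norm_num
  have : c * 2 = 1 := by exact_mod_cast this
  omega


lemma aux_real {K : Type*} [Field K] [NumberField K] (q : ℕ) (hq5 : q % 8 = 5) (hdegK : Module.finrank ℚ K = 2)
    (r : K) (hr : r ^ 2 = (q : K)) (τ : K →+* ℂ) (z : K) : (starRingEnd ℂ) (τ z) = τ z := by
  have h1 : (starRingEnd ℂ) (τ r) = τ r := by
    have h : (τ r) ^ 2 = ((Real.sqrt q : ℝ) : ℂ) ^ 2 := by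
      rw [← map_pow, hr, ← Complex.ofReal_pow, Real.sq_sqrt (Nat.cast_nonneg q)]; simp
    rcases sq_eq_sq_iff_eq_or_eq_neg.mp h with h | h <;> rw [h] <;> simp
  obtain ⟨a, b, rfl⟩ := aux_coord q hq5 hdegK r hr z
  simp [h1]

lemma aux_root {K : Type*} [Field K] [NumberField K] (q : ℕ) (hq5 : q % 8 = 5) (hdegK : Module.finrank ℚ K = 2)
    (r : K) (hr : r ^ 2 = (q : K)) (z : K) (m : ℕ) (hm : 0 < m) (h : z ^ m = 1) : z = 1 ∨ z = -1 := by
  obtain ⟨τ⟩ : Nonempty (K →+* ℂ) := inferInstance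
  have h1 := aux_real q hq5 hdegK r hr τ z
  have h2 : ‖τ z‖ = 1 := Complex.norm_eq_one_of_pow_eq_one (by rw [← map_pow, h, map_one]) hm.ne'
  have h3 := Complex.mul_conj (τ z)
  rw [h1, Complex.normSq_eq_norm_sq, h2] at h3
  have h4 : z * z = 1 := by
    apply τ.injective
    simpa using h3
  exact mul_self_eq_one_iff.mp h4

theorem stmt_14 (p q : ℕ) (hp : p.Prime) (hq : q.Prime) (hpq : p ≠ q)
    (hp8 : p % 8 = 1) (hq5 : q % 8 = 5)
    (K : Type*) [Field K] [NumberField K] (hdegK : Module.finrank ℚ K = 2)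
    (sqq : K) (hsqq : sqq ^ 2 = (q : K))
    (ε : (𝓞 K)ˣ)
    (hεinf : ∀ m : ℕ, 0 < m → ε ^ m ≠ 1)
    (hεfund : ∀ u : (𝓞 K)ˣ, ∃ (ζ : (𝓞 K)ˣ) (k : ℤ),
      (∃ m : ℕ, 0 < m ∧ ζ ^ m = 1) ∧ u = ζ * ε ^ k)
    (F : Type*) [Field F] [NumberField F] (hdegF : Module.finrank ℚ F = 4)
    (φ : K →+* F) (im : F) (him : im ^ 2 = -1) :
    ∀ u : (𝓞 F)ˣ, ∃ (a : ℕ) (b : ℤ),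
      ((u : 𝓞 F) : F) = im ^ a * (φ ((ε : 𝓞 K) : K)) ^ b := by
  intro u
  -- units of `K`
  have hunit : ∀ x : K, x ≠ 0 → IsIntegral ℤ x → IsIntegral ℤ x⁻¹ →
      ∃ (a : ℕ) (b : ℤ), φ x = im ^ a * (φ ((ε : 𝓞 K) : K)) ^ b := by
    intro x hx h1 h2
    let w : (𝓞 K)ˣ := ⟨⟨x, h1⟩, ⟨x⁻¹, h2⟩, by
      apply RingOfIntegers.ext; exact mul_inv_cancel₀ hx, by
      apply RingOfIntegers.ext; exact inv_mul_cancel₀ hx⟩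
    obtain ⟨ζ, k, ⟨m, hm, hζ⟩, hw⟩ := hεfund w
    have hw' : x = ((ζ : 𝓞 K) : K) * ((ε : 𝓞 K) : K) ^ k := by
      have : x = ((w : 𝓞 K) : K) := rfl
      rw [this, hw]
      simp [NumberField.Units.coe_zpow]
    have hζ' : ((ζ : 𝓞 K) : K) ^ m = 1 := by
      have := congrArg (fun z : (𝓞 K)ˣ => ((z : 𝓞 K) : K)) hζ
      simpa using this
    rcases aux_root q hq5 hdegK sqq hsqq _ m hm hζ' with h | h
    · exact ⟨0, k, by rw [hw', h]; simp⟩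
    · exact ⟨2, k, by rw [hw', h]; simp [him]⟩
  -- coordinates
  let _ : Algebra K F := φ.toAlgebra
  have hφ : ∀ x, algebraMap K F x = φ x := fun _ => rfl
  have hfin : Module.finrank K F = 2 := by
    have := Module.finrank_mul_finrank ℚ K F
    rw [hdegK, hdegF] at this
    omega
  have hintφ : ∀ x : K, IsIntegral ℤ (φ x) → IsIntegral ℤ x := by
    intro x hx
    exact (isIntegral_algebraMap_iff (algebraMap K F).injective).mp hx
  have hcoord : ∀ z : F, ∃ x y : K, z = φ x + φ y * im := by
    intro z
    refine aux_basis K F hfin im ?_ z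
    intro x hx
    apply aux_sq_ne q hq5 hdegK sqq hsqq x
    apply φ.injective
    rw [hφ] at hx
    rw [map_pow, hx, him]; simp
  -- complex conjugation
  obtain ⟨τ⟩ : Nonempty (F →+* ℂ) := inferInstance
  have hconj : ∀ x y : K, IsIntegral ℤ (φ x + φ y * im) → IsIntegral ℤ (φ x - φ y * im) := by
    intro x y h
    have him' : (starRingEnd ℂ) (τ im) = - τ im := by
      have h : (τ im) ^ 2 = Complex.I ^ 2 := by
        rw [← map_pow, him]; simp
      rcases sq_eq_sq_iff_eq_or_eq_neg.mp h with h | h <;> rw [h] <;> simp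
    have hre : ∀ x, (starRingEnd ℂ) (τ (φ x)) = τ (φ x) := fun x =>
      aux_real q hq5 hdegK sqq hsqq (τ.comp φ) x
    have h1 := h.map (((starRingEnd ℂ).comp τ).toIntAlgHom)
    have h2 : IsIntegral ℤ (τ.toIntAlgHom (φ x - φ y * im)) := by
      convert h1 using 1
      simp [him', hre]
      ring
    exact (isIntegral_algHom_iff τ.toIntAlgHom τ.injective).mp h2
  have hu : IsIntegral ℤ ((u : 𝓞 F) : F) := (u : 𝓞 F).isIntegral_coe
  have hv : IsIntegral ℤ (((u⁻¹ : (𝓞 F)ˣ) : 𝓞 F) : F) := ((u⁻¹ : (𝓞 F)ˣ) : 𝓞 F).isIntegral_coe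
  have huv : ((u : 𝓞 F) : F) * (((u⁻¹ : (𝓞 F)ˣ) : 𝓞 F) : F) = 1 := by
    rw [← map_mul]; simp
  generalize ((u : 𝓞 F) : F) = U at *
  generalize (((u⁻¹ : (𝓞 F)ˣ) : 𝓞 F) : F) = V at *
  obtain ⟨x, y, rfl⟩ := hcoord U
  have hub := hconj x y hu
  have hU0 : φ x + φ y * im ≠ 0 := left_ne_zero_of_mul_eq_one huv
  have hn0 : x ^ 2 + y ^ 2 ≠ 0 := by
    intro h
    by_cases hy : y = 0
    · subst hy
      have hx : x = 0 := by simpa using h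
      subst hx
      simp at hU0
    · apply aux_sq_ne q hq5 hdegK sqq hsqq (x / y)
      field_simp
      linear_combination h
  have hn0' : φ x ^ 2 + φ y ^ 2 ≠ 0 := by
    rw [← map_pow, ← map_pow, ← map_add]; exact (map_ne_zero φ).mpr hn0
  have hVeq : V = φ (x / (x ^ 2 + y ^ 2)) + φ (-y / (x ^ 2 + y ^ 2)) * im := by
    apply mul_left_cancel₀ hU0
    rw [huv]
    simp only [map_div₀, map_add, map_pow, map_neg]
    field_simp
    linear_combination (φ y) ^ 2 * him
  rw [hVeq] at hv
  have hvb := hconj _ _ hv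
  have hnint : IsIntegral ℤ (x ^ 2 + y ^ 2) := by
    apply hintφ
    refine aux_congr (hu.mul hub) ?_
    simp only [map_add, map_pow]
    linear_combination (φ y) ^ 2 * him
  have hninv : IsIntegral ℤ (x ^ 2 + y ^ 2)⁻¹ := by
    apply hintφ
    refine aux_congr (hv.mul hvb) ?_
    simp only [map_div₀, map_add, map_pow, map_neg, map_inv₀]
    field_simp
    linear_combination (φ y) ^ 2 * him
  have h2c : IsIntegral ℤ (2 * ((x ^ 2 - y ^ 2) / (x ^ 2 + y ^ 2))) := by
    apply hintφ
    refine aux_congr ((hu.mul hvb).add (hub.mul hv)) ?_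
    simp only [map_div₀, map_add, map_sub, map_mul, map_pow, map_neg, map_ofNat]
    field_simp
    linear_combination (-2 * (φ y) ^ 2) * him
  have him2 : IsIntegral ℤ im := IsIntegral.of_pow (n := 2) (by norm_num) (by
    rw [him]; exact isIntegral_one.neg)
  have hdiag : ∀ s : K, (s = 1 ∨ s = -1) → y = s * x → False := by
    intro s hs hy
    have hs2 : s ^ 2 = 1 := by rcases hs with h | h <;> simp [h]
    have hn : x ^ 2 + y ^ 2 = 2 * x ^ 2 := by rw [hy, mul_pow, hs2]; ring
    have hx0 : x ≠ 0 := by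
      rintro hx
      rw [hn, hx] at hn0
      simp at hn0
    have hsint : IsIntegral ℤ (φ s) := by
      rcases hs with h | h <;> rw [h] <;> simp [isIntegral_one]
    have ht : IsIntegral ℤ x⁻¹ := by
      apply hintφ
      have h1 := (isIntegral_one.add (hsint.mul him2)).mul hv
      refine aux_congr (h1) ?_
      have hx0' : φ x ≠ 0 := by simpa using hx0
      have hs2' : φ s ^ 2 = 1 := by rw [← map_pow, hs2, map_one]
      rw [hn, hy]
      simp only [map_div₀, map_pow, map_neg, map_inv₀, map_mul, map_ofNat]
      field_simp
      linear_combination (φ s) ^ 2 * him - hs2'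
    have h3 := aux_inert q hq hq5 hdegK sqq hsqq x⁻¹ _ ht hninv (by
      rw [hn]; field_simp)
    apply aux_half (L := K)
    refine aux_congr (hnint.mul (h3.mul h3)) ?_
    rw [hn]; field_simp
  rcases aux_cd q hq hq5 hdegK sqq hsqq ((x ^ 2 - y ^ 2) / (x ^ 2 + y ^ 2))
    (2 * x * y / (x ^ 2 + y ^ 2)) (by field_simp; ring) h2c with h | h
  · exfalso
    rw [div_eq_zero_iff] at h
    have h' : x ^ 2 = y ^ 2 := sub_eq_zero.mp (h.resolve_right hn0)
    rcases sq_eq_sq_iff_eq_or_eq_neg.mp h' with h | h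
    · exact hdiag 1 (Or.inl rfl) (by rw [h]; ring)
    · exact hdiag (-1) (Or.inr rfl) (by rw [h]; ring)
  · rw [div_eq_zero_iff] at h
    have h' : x = 0 ∨ y = 0 := by simpa using h.resolve_right hn0
    rcases h' with h | h
    · subst h
      have hy0 : y ≠ 0 := by rintro rfl; simp at hn0
      simp only [zero_pow two_ne_zero, zero_add] at hnint hninv
      have h1 : IsIntegral ℤ y := IsIntegral.of_pow (n := 2) (by norm_num) hnint
      have h2 : IsIntegral ℤ y⁻¹ := IsIntegral.of_pow (n := 2) (by norm_num) (by
        rw [inv_pow]; exact hninv)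
      obtain ⟨a, b, hab⟩ := hunit y hy0 h1 h2
      exact ⟨a + 1, b, by rw [hab, map_zero]; ring⟩
    · subst h
      have hx0 : x ≠ 0 := by rintro rfl; simp at hn0
      simp only [zero_pow two_ne_zero, add_zero] at hnint hninv
      have h1 : IsIntegral ℤ x := IsIntegral.of_pow (n := 2) (by norm_num) hnint
      have h2 : IsIntegral ℤ x⁻¹ := IsIntegral.of_pow (n := 2) (by norm_num) (by
        rw [inv_pow]; exact hninv)
      obtain ⟨a, b, hab⟩ := hunit x hx0 h1 h2
      exact ⟨a, b, by rw [hab, map_zero]; ring⟩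
end
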